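/- Let G, H, and K be games over the same poset A, and suppose H is premotive. Then: (A) if G ≤ H and H ≤ K, then G ≤ K; (B) if G ◁ H and H ≤ K, then G ◁ K; (C) if G ≤ H and H ◁ K, then G ◁ K. (That is, the intrinsic order is transitive through premotive games.) -/

import Mathlib

/-- Games over a poset `α`: atomic games `[a]` for `a : α`, and composite games
`⟨L|R⟩` given by nonempty families of left and right options. -/
inductive Game (α : Type) : Type 1 where
  | atom : α → Game α
  | comp : (ι κ : Type) → (ι → Game α) → (κ → Game α) → Nonempty ι → Nonempty κ → Game α

namespace Game

variable {α β : Type}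

/-- `G'` is a left option of the game. -/
def IsLeftOption (G' : Game α) : Game α → Prop
  | atom _ => False
  | comp _ _ L _ _ _ => ∃ i, L i = G'

/-- `G'` is a right option of the game. -/
def IsRightOption (G' : Game α) : Game α → Prop
  | atom _ => False
  | comp _ _ _ R _ _ => ∃ k, R k = G'

/-- `G'` is an option of `G`. -/
def IsOption (G' G : Game α) : Prop := IsLeftOption G' G ∨ IsRightOption G' G

/-- A game is composite if it is not atomic. -/
def IsComposite : Game α → Prop
  | atom _ => False
  | comp _ _ _ _ _ _ => True

/-- `G'` is a follower of `G`: `G` itself, an option of `G`, or recursively a follower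
of an option of `G`. -/
def IsFollower (G' G : Game α) : Prop := Relation.ReflTransGen IsOption G' G

/-- The dual game: Left and Right switch sides; it is a game over the opposite poset. -/
def dual : Game α → Game αᵒᵈ
  | atom a => atom (OrderDual.toDual a)
  | comp ι κ L R hι hκ => comp κ ι (fun k => (R k).dual) (fun i => (L i).dual) hκ hι

/-- The image of a game under a (monotone) function applied to atoms. -/
def map (f : α → β) : Game α → Game β
  | atom a => atom (f a)
  | comp ι κ L R hι hκ => comp ι κ (fun i => (L i).map f) (fun k => (R k).map f) hι hκ

/-- The (disjunctive) sum of a game over `α` and a game over `β`, a game over `α × β`. -/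
noncomputable def add : Game α → Game β → Game (α × β) := by
  intro G
  induction G with
  | atom g =>
    intro H
    induction H with
    | atom h => exact atom (g, h)
    | comp ι κ L R hι hκ IHL IHR => exact comp ι κ IHL IHR hι hκ
  | comp ι κ L R hι hκ IHL IHR =>
    intro H
    induction H with
    | atom h => exact comp ι κ (fun i => IHL i (atom h)) (fun k => IHR k (atom h)) hι hκ
    | comp ι' κ' L' R' hι' hκ' IHL' IHR' =>
      exact comp (ι ⊕ ι') (κ ⊕ κ')
        (Sum.elim (fun i => IHL i (comp ι' κ' L' R' hι' hκ')) IHL')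
        (Sum.elim (fun k => IHR k (comp ι' κ' L' R' hι' hκ')) IHR')
        (hι.elim fun i => ⟨Sum.inl i⟩) (hκ.elim fun k => ⟨Sum.inl k⟩)

mutual
/-- Left has a first player winning strategy in a game over the boolean poset:
either the game is the atom `⊤`, or some left option has a second player
winning strategy for Left. -/
inductive LeftWinsFirst : Game Bool → Prop where
  | atom_top : LeftWinsFirst (atom true)
  | move {G G' : Game Bool} : IsLeftOption G' G → LeftWinsSecond G' → LeftWinsFirst G

/-- Left has a second player winning strategy in a game over the boolean poset:
every right option has a first player winning strategy for Left, and if the game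
is atomic it is the atom `⊤`. -/
inductive LeftWinsSecond : Game Bool → Prop where
  | mk {G : Game Bool} : (∀ G', IsRightOption G' G → LeftWinsFirst G') →
      (∀ b, G = atom b → b = true) → LeftWinsSecond G
end

mutual
/-- A game is even if all of its options are odd (atomic games are even). -/
inductive Even {α : Type} : Game α → Prop where
  | mk {G : Game α} : (∀ G', IsOption G' G → Odd G') → Even G

/-- A game is odd if it is composite and all of its options are even. -/
inductive Odd {α : Type} : Game α → Prop where
  | mk {G : Game α} : G.IsComposite → (∀ G', IsOption G' G → Even G') → Odd G
end

/-- A game has parity if it is even or odd. -/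
def HasParity (G : Game α) : Prop := Even G ∨ Odd G

/-- `G` and `H` have matching parity (both even or both odd). -/
def MatchingParity (G H : Game α) : Prop := (Even G ∧ Even H) ∨ (Odd G ∧ Odd H)

/-- `G` and `H` have mismatching parity (one even, the other odd). -/
def MismatchParity (G H : Game α) : Prop := (Even G ∧ Odd H) ∨ (Odd G ∧ Even H)

mutual
/-- The intrinsic order `G ≤ H` on games over a poset: every left option `G^L` of `G`
satisfies `G^L ◁ H`, every right option `H^R` of `H` satisfies `G ◁ H^R`, and if
both games are atoms `[g]`, `[h]` then `g ≤ h`. -/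
inductive Le {α : Type} [PartialOrder α] : Game α → Game α → Prop where
  | mk {G H : Game α} :
      (∀ G', IsLeftOption G' G → Tri G' H) →
      (∀ H', IsRightOption H' H → Tri G H') →
      (∀ g h, G = atom g → H = atom h → g ≤ h) →
      Le G H

/-- The intrinsic relation `G ◁ H` on games over a poset: some right option `G^R` of `G`
satisfies `G^R ≤ H`, or some left option `H^L` of `H` satisfies `G ≤ H^L`. -/
inductive Tri {α : Type} [PartialOrder α] : Game α → Game α → Prop where
  | inr {G H G' : Game α} : IsRightOption G' G → Le G' H → Tri G H
  | inl {G H H' : Game α} : IsLeftOption H' H → Le G H' → Tri G H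
end

/-- The comparison game `λ(Gᵒᵖ + H)`, a game over the boolean poset, where
`λ : αᵒᵈ × α → 𝔹` is the monotone map with `λ(xᵒᵖ, y) = ⊤` iff `x ≤ y`. -/
noncomputable def comparison [PartialOrder α] (G H : Game α) : Game Bool :=
  map (fun p : αᵒᵈ × α => @decide (OrderDual.ofDual p.1 ≤ p.2) (Classical.propDecidable _))
    (G.dual.add H)

/-- A game is locally premotive if Left has a first player winning strategy in
the comparison game `λ(Gᵒᵖ + G)`. -/
def LocallyPremotive [PartialOrder α] (G : Game α) : Prop := LeftWinsFirst (comparison G G)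

/-- A game is premotive if it and all of its followers are locally premotive. -/
def Premotive [PartialOrder α] (G : Game α) : Prop :=
  ∀ G', IsFollower G' G → LocallyPremotive G'

/-- The game `* = ⟨0|0⟩` over the one-element poset. -/
def star : Game Unit := comp Unit Unit (fun _ => atom ()) (fun _ => atom ()) ⟨()⟩ ⟨()⟩

/-- `G + *`, identified with a game over `α` via the isomorphism `α × 1 ≅ α`. -/
noncomputable def addStar (G : Game α) : Game α := map Prod.fst (G.add star)

/-- A game is locally `*`-antimonotone if `G^L + * ≤ G ≤ G^R + *` for all left and
right options `G^L`, `G^R`. -/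
def LocallyStarAnti [PartialOrder α] (G : Game α) : Prop :=
  (∀ G', IsLeftOption G' G → Le G'.addStar G) ∧ (∀ G', IsRightOption G' G → Le G G'.addStar)

/-- A game is `*`-antimonotone if it and all of its followers are locally
`*`-antimonotone. -/
def StarAnti [PartialOrder α] (G : Game α) : Prop :=
  ∀ G', IsFollower G' G → LocallyStarAnti G'

/-- `ε(G + X)`: the game `G` over `α` embedded in a context `X`, a game over the poset
`[α, 𝔹]` of monotone functions `α → 𝔹`, via the application map `ε(a, f) = f a`. -/
noncomputable def ctxSum [PartialOrder α] (G : Game α) (X : Game (α →o Bool)) : Game Bool :=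
  map (fun p : α × (α →o Bool) => p.2 p.1) (G.add X)

/-- The outcome `(o_L(G), o_R(G)) ∈ 𝔹 × 𝔹` of a game over the boolean poset:
`o_L(G) = ⊤` iff Left has a first player winning strategy and `o_R(G) = ⊤` iff
Left has a second player winning strategy. -/
noncomputable def outcome (G : Game Bool) : Bool × Bool :=
  (@decide (LeftWinsFirst G) (Classical.propDecidable _),
   @decide (LeftWinsSecond G) (Classical.propDecidable _))

/-- The contextual order `G ≤_c H`: `o(G+X) ≤ o(H+X)` for every context `X`. -/
def ContextualLe [PartialOrder α] (G H : Game α) : Prop :=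
  ∀ X : Game (α →o Bool), outcome (ctxSum G X) ≤ outcome (ctxSum H X)

/-- The contextual relation `G ◁_c H`: `o_R(G+X) ≤ o_L(H+X)` for every context `X`. -/
def ContextualTri [PartialOrder α] (G H : Game α) : Prop :=
  ∀ X : Game (α →o Bool), (outcome (ctxSum G X)).2 ≤ (outcome (ctxSum H X)).1

/-- Two games are identical when they are equal as set-based games: both are the same
atom, or both are composite with identical sets of left options and identical sets of
right options (recursively). -/
def Identical : Game α → Game α → Prop
  | atom a, atom b => a = b
  | comp _ _ L R _ _, comp _ _ L' R' _ _ =>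
      ((∀ i, ∃ i', Identical (L i) (L' i')) ∧ (∀ i', ∃ i, Identical (L i) (L' i'))) ∧
      ((∀ k, ∃ k', Identical (R k) (R' k')) ∧ (∀ k', ∃ k, Identical (R k) (R' k')))
  | _, _ => False

theorem option_induction {α : Type} {P : Game α → Prop}
    (h : ∀ G, (∀ G', IsOption G' G → P G') → P G) (G : Game α) : P G := by
  induction G with
  | atom a =>
    apply h
    rintro G' (h | h)
    · exact h.elim
    · exact h.elim
  | comp ι κ L R hι hκ ihL ihR =>
    apply h
    rintro G' (⟨i, rfl⟩ | ⟨i, rfl⟩)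
    · exact ihL i
    · exact ihR i

theorem comparison_left {α : Type} [PartialOrder α] {X : Game Bool} {G H : Game α}
    (h : IsLeftOption X (comparison G H)) :
    (∃ G', IsRightOption G' G ∧ X = comparison G' H) ∨
    (∃ H', IsLeftOption H' H ∧ X = comparison G H') := by
  cases G with
  | atom g =>
    cases H with
    | atom k => exact h.elim
    | comp ι κ L R hι hκ =>
      obtain ⟨i, rfl⟩ := h
      exact Or.inr ⟨L i, ⟨i, rfl⟩, rfl⟩
  | comp ι κ L R hι hκ =>
    cases H with
    | atom k =>
      obtain ⟨i, rfl⟩ := h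
      exact Or.inl ⟨R i, ⟨i, rfl⟩, rfl⟩
    | comp ι' κ' L' R' hι' hκ' =>
      obtain ⟨i | i, rfl⟩ := h
      · exact Or.inl ⟨R i, ⟨i, rfl⟩, rfl⟩
      · exact Or.inr ⟨L' i, ⟨i, rfl⟩, rfl⟩

theorem comparison_right_fst {α : Type} [PartialOrder α] {G G' H : Game α}
    (h : IsLeftOption G' G) : IsRightOption (comparison G' H) (comparison G H) := by
  cases G with
  | atom g => exact h.elim
  | comp ι κ L R hι hκ =>
    obtain ⟨i, rfl⟩ := h
    cases H with
    | atom k => exact ⟨i, rfl⟩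
    | comp ι' κ' L' R' hι' hκ' => exact ⟨Sum.inl i, rfl⟩

theorem comparison_right_snd {α : Type} [PartialOrder α] {G H' H : Game α}
    (h : IsRightOption H' H) : IsRightOption (comparison G H') (comparison G H) := by
  cases H with
  | atom g => exact h.elim
  | comp ι κ L R hι hκ =>
    obtain ⟨i, rfl⟩ := h
    cases G with
    | atom k => exact ⟨i, rfl⟩
    | comp ι' κ' L' R' hι' hκ' => exact ⟨Sum.inr i, rfl⟩

theorem comparison_atom {α : Type} [PartialOrder α] {G H : Game α}
    (h : comparison G H = atom true) : ∃ g k, G = atom g ∧ H = atom k ∧ g ≤ k := by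
  cases G with
  | atom g =>
    cases H with
    | atom k =>
      refine ⟨g, k, rfl, rfl, ?_⟩
      have h2 := Game.atom.inj h
      exact @of_decide_eq_true _ (Classical.propDecidable _) h2
    | comp ι κ L R hι hκ => exact Game.noConfusion rfl (heq_of_eq h)
  | comp ι κ L R hι hκ =>
    cases H with
    | atom k => exact Game.noConfusion rfl (heq_of_eq h)
    | comp ι' κ' L' R' hι' hκ' => exact Game.noConfusion rfl (heq_of_eq h)

/-- Playing the comparison game on `H₁, H₂` against atomic bounds on both sides. -/
theorem chase {α : Type} [PartialOrder α] (g k : α) (H₁ : Game α) : ∀ H₂ : Game α,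
    (Le (atom g) H₁ → LeftWinsFirst (comparison H₁ H₂) → Le H₂ (atom k) → g ≤ k) ∧
    (Tri (atom g) H₁ → LeftWinsSecond (comparison H₁ H₂) → Le H₂ (atom k) → g ≤ k) ∧
    (Le (atom g) H₁ → LeftWinsSecond (comparison H₁ H₂) → Tri H₂ (atom k) → g ≤ k) := by
  induction H₁ using option_induction with
  | h H₁ ih₁ =>
  intro H₂
  induction H₂ using option_induction with
  | h H₂ ih₂ =>
  refine ⟨?_, ?_, ?_⟩
  · intro hG hW hK
    generalize hX : comparison H₁ H₂ = X at hW
    cases hW with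
    | atom_top =>
      obtain ⟨a, b, rfl, rfl, hab⟩ := comparison_atom hX
      obtain ⟨_, _, h1⟩ := hG
      obtain ⟨_, _, h2⟩ := hK
      exact (h1 _ _ rfl rfl).trans (hab.trans (h2 _ _ rfl rfl))
    | move hY hS =>
      subst hX
      obtain ⟨H', hH', rfl⟩ | ⟨H', hH', rfl⟩ := comparison_left hY
      · obtain ⟨_, h1, _⟩ := hG
        exact (ih₁ H' (Or.inr hH') H₂).2.1 (h1 _ hH') hS hK
      · obtain ⟨h2, _, _⟩ := hK
        exact (ih₂ H' (Or.inl hH')).2.2 hG hS (h2 _ hH')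
  · intro hG hW hK
    obtain ⟨hw, _⟩ := hW
    rcases hG with ⟨h, _⟩ | ⟨h, hle⟩
    · exact h.elim
    · exact (ih₁ _ (Or.inl h) H₂).1 hle (hw _ (comparison_right_fst h)) hK
  · intro hG hW hK
    obtain ⟨hw, _⟩ := hW
    rcases hK with ⟨h, hle⟩ | ⟨h, _⟩
    · exact (ih₂ _ (Or.inr h)).1 hG (hw _ (comparison_right_snd h)) hle
    · exact h.elim

theorem Premotive.option {α : Type} [PartialOrder α] {H H' : Game α} (hH : Premotive H)
    (h : IsOption H' H) : Premotive H' :=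
  fun G' hG' => hH G' (Relation.ReflTransGen.tail hG' h)

theorem trans_aux {α : Type} [PartialOrder α] (H : Game α) : Premotive H → ∀ G K : Game α,
    (Le G H → Le H K → Le G K) ∧
    (Tri G H → Le H K → Tri G K) ∧
    (Le G H → Tri H K → Tri G K) := by
  induction H using option_induction with
  | h H ihH =>
  intro hH G
  induction G using option_induction with
  | h G ihG =>
  intro K
  induction K using option_induction with
  | h K ihK =>
  refine ⟨?_, ?_, ?_⟩
  · intro hGH hHK
    refine Le.mk ?_ ?_ ?_
    · intro G' hG'
      obtain ⟨h1, _, _⟩ := hGH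
      exact (ihG G' (Or.inl hG') K).2.1 (h1 _ hG') hHK
    · intro K' hK'
      obtain ⟨_, h1, _⟩ := hHK
      exact (ihK K' (Or.inr hK')).2.2 hGH (h1 _ hK')
    · rintro g k rfl rfl
      exact (chase g k H H).1 hGH (hH H Relation.ReflTransGen.refl) hHK
  · intro hGH hHK
    rcases hGH with ⟨h, hle⟩ | ⟨h, hle⟩
    · exact Tri.inr h ((ihG _ (Or.inr h) K).1 hle hHK)
    · obtain ⟨h1, _, _⟩ := hHK
      exact (ihH _ (Or.inl h) (hH.option (Or.inl h)) G K).2.2 hle (h1 _ h)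
  · intro hGH hHK
    rcases hHK with ⟨h, hle⟩ | ⟨h, hle⟩
    · obtain ⟨_, h1, _⟩ := hGH
      exact (ihH _ (Or.inr h) (hH.option (Or.inr h)) G K).2.1 (h1 _ h) hle
    · exact Tri.inl h ((ihK _ (Or.inl h)).1 hGH hle)

/-- The intrinsic order is transitive through premotive games. -/
theorem trans_of_premotive {α : Type} [PartialOrder α] (G H K : Game α)
    (hH : Premotive H) :
    (Le G H → Le H K → Le G K) ∧
    (Tri G H → Le H K → Tri G K) ∧
    (Le G H → Tri H K → Tri G K) :=
  trans_aux H hH G K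

end Game
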